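/- arXiv:2202.12046 — 2 statements merged into one kernel-verified Lean document; each statement's English description precedes it below -/
import Mathlib

section
/- If I is an independent family of subsets of ℕ, then fil(I) = ⋃{fil(J) : J ⊆ I and J is countable}. -/
/-- Finite partial functions from `I` to `{0,1}` (encoded as `Set ℕ → Option Bool`). -/
def FF (I : Set (Set ℕ)) : Set (Set ℕ → Option Bool) :=
  {g | {A : Set ℕ | g A ≠ none}.Finite ∧ ∀ A : Set ℕ, g A ≠ none → A ∈ I}

/-- `g` extends `g'` as a partial function. -/
def FFExtends (g g' : Set ℕ → Option Bool) : Prop :=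
  ∀ (A : Set ℕ) (b : Bool), g' A = some b → g A = some b

/-- The boolean combination `I^g`: intersection of the sets mapped to `1`
and complements of the sets mapped to `0` (so `I^∅ = ℕ`). -/
def boolComb (g : Set ℕ → Option Bool) : Set ℕ :=
  {n | ∀ A : Set ℕ, (g A = some true → n ∈ A) ∧ (g A = some false → n ∉ A)}

/-- `I` is an independent family. -/
def IndepFam (I : Set (Set ℕ)) : Prop :=
  (∀ A ∈ I, A.Infinite) ∧ ∀ g ∈ FF I, (boolComb g).Infinite

/-- The density filter `fil(I)`. -/
def densityFil (I : Set (Set ℕ)) : Set (Set ℕ) :=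
  {X | ∀ g' ∈ FF I, ∃ g ∈ FF I, FFExtends g g' ∧ (boolComb g \ X).Finite}

/-- The density ideal `id(I)`. -/
def densityIdl (I : Set (Set ℕ)) : Set (Set ℕ) :=
  {X | ∀ g' ∈ FF I, ∃ g ∈ FF I, FFExtends g g' ∧ (boolComb g ∩ X).Finite}

/-- `I` is densely maximal. -/
def DenselyMaximal (I : Set (Set ℕ)) : Prop :=
  ∀ X : Set ℕ, X.Infinite → ∀ g' ∈ FF I, ∃ g ∈ FF I, FFExtends g g' ∧
    ((boolComb g ∩ X).Finite ∨ (boolComb g \ X).Finite)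

theorem FF_mono {I J : Set (Set ℕ)} (h : J ⊆ I) : FF J ⊆ FF I :=
  fun _ hg => ⟨hg.1, fun A hA => h (hg.2 A hA)⟩

theorem FF_countable {J : Set (Set ℕ)} (hJ : J.Countable) : (FF J).Countable := by
  have hc := Set.countable_ofPred_finite_subset hJ
  refine Set.MapsTo.countable_of_injOn
    (f := fun g : Set ℕ → Option Bool => ({A | g A = some true}, {A | g A = some false}))
    (t := {t | t.Finite ∧ t ⊆ J} ×ˢ {t | t.Finite ∧ t ⊆ J}) ?_ ?_ (hc.prod hc)
  · intro g hg
    have key : ∀ b : Bool, {A | g A = some b} ∈ {t : Set (Set ℕ) | t.Finite ∧ t ⊆ J} := by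
      intro b
      have hsub : ∀ A ∈ {A | g A = some b}, g A ≠ none := by
        intro A hA
        simp_all
      exact ⟨hg.1.subset hsub, fun A hA => hg.2 A (hsub A hA)⟩
    exact ⟨key true, key false⟩
  · intro g _ g' _ h
    simp only [Prod.mk.injEq, Set.ext_iff, Set.mem_ofPred_eq] at h
    funext A
    refine Option.ext fun b => ?_
    cases b
    · exact h.2 A
    · exact h.1 A

theorem exists_mem_FF_of_mem_FF_iUnion {J : ℕ → Set (Set ℕ)} (hJ : Monotone J)
    {g : Set ℕ → Option Bool} (hg : g ∈ FF (⋃ n, J n)) : ∃ n, g ∈ FF (J n) := by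
  have h : ∀ A, ∃ n, g A ≠ none → A ∈ J n := by
    intro A
    by_cases hA : g A = none
    · exact ⟨0, fun h => absurd hA h⟩
    · obtain ⟨n, hn⟩ := Set.mem_iUnion.1 (hg.2 A hA)
      exact ⟨n, fun _ => hn⟩
  choose k hk using h
  obtain ⟨n, hn⟩ := (hg.1.image k).bddAbove
  exact ⟨n, hg.1, fun A hA => hJ (hn ⟨A, hA, rfl⟩) (hk A hA)⟩

theorem boolComb_anti {g g' : Set ℕ → Option Bool} (h : FFExtends g g') :
    boolComb g ⊆ boolComb g' :=
  fun _ hn A => ⟨fun hA => (hn A).1 (h A _ hA), fun hA => (hn A).2 (h A _ hA)⟩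

theorem densityFil_mono {I J : Set (Set ℕ)} (h : J ⊆ I) : densityFil J ⊆ densityFil I := by
  classical
  intro X hX g' hg'
  obtain ⟨g, hg, hext, hfin⟩ := hX (fun A => if A ∈ J then g' A else none)
    ⟨hg'.1.subset fun A hA => by simp_all, fun A hA => by by_contra; simp_all⟩
  refine ⟨fun A => (g A).or (g' A), ⟨?_, ?_⟩, ?_, hfin.subset ?_⟩
  · refine (hg.1.union hg'.1).subset fun A hA => ?_
    by_contra hn
    simp_all
  · intro A hA
    by_cases hgA : g A = none
    · exact hg'.2 A fun hn => hA (by simp [hgA, hn])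
    · exact h (hg.2 A hgA)
  · intro A b hb
    by_cases hgA : g A = none
    · simp [hgA, hb]
    · have hgb : g A = some b := hext A b (by simp [hg.2 A hgA, hb])
      simp [hgb]
  · exact Set.sdiff_subset_sdiff_left (boolComb_anti fun A b hb => by simp [hb])

theorem exists_countable_mem_densityFil {I : Set (Set ℕ)} {X : Set ℕ} (hX : X ∈ densityFil I) :
    ∃ J ⊆ I, J.Countable ∧ X ∈ densityFil J := by
  have hX' : ∀ g', ∃ g, g' ∈ FF I → g ∈ FF I ∧ FFExtends g g' ∧ (boolComb g \ X).Finite := by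
    intro g'
    by_cases hg' : g' ∈ FF I
    · obtain ⟨g, hg⟩ := hX g' hg'
      exact ⟨g, fun _ => hg⟩
    · exact ⟨g', fun h => absurd h hg'⟩
  choose F hF using hX'
  let J : ℕ → Set (Set ℕ) := fun n =>
    Nat.rec ∅ (fun _ K => K ∪ ⋃ g ∈ FF K, {A | F g A ≠ none}) n
  have hsucc : ∀ n, J (n + 1) = J n ∪ ⋃ g ∈ FF (J n), {A | F g A ≠ none} := fun _ => rfl
  have hmono : Monotone J := monotone_nat_of_le_succ fun n => by
    rw [hsucc]
    exact Set.subset_union_left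
  have hJ : ∀ n, J n ⊆ I ∧ (J n).Countable := by
    intro n
    induction n with
    | zero => exact ⟨Set.empty_subset _, Set.countable_empty⟩
    | succ n ih =>
      rw [hsucc]
      refine ⟨Set.union_subset ih.1 (Set.iUnion₂_subset fun g hg => ?_),
        ih.2.union ((FF_countable ih.2).biUnion fun g hg => ?_)⟩
      · exact (hF g (FF_mono ih.1 hg)).1.2
      · exact (hF g (FF_mono ih.1 hg)).1.1.countable
  refine ⟨⋃ n, J n, Set.iUnion_subset fun n => (hJ n).1,
    Set.countable_iUnion fun n => (hJ n).2, fun g' hg' => ?_⟩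
  obtain ⟨n, hn⟩ := exists_mem_FF_of_mem_FF_iUnion hmono hg'
  obtain ⟨hg, hext, hfin⟩ := hF g' (FF_mono (hJ n).1 hn)
  refine ⟨F g', ⟨hg.1, fun A hA => Set.mem_iUnion.2 ⟨n + 1, ?_⟩⟩, hext, hfin⟩
  rw [hsucc]
  exact Or.inr (Set.mem_biUnion hn hA)


/-- If `I` is an independent family then `fil(I)` is the union of the filters
`fil(J)` over countable `J ⊆ I`. -/
theorem densityFil_eq_iUnion_countable (I : Set (Set ℕ)) (hI : IndepFam I) :
    densityFil I = ⋃ J ∈ {J : Set (Set ℕ) | J ⊆ I ∧ J.Countable}, densityFil J := by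
  ext X
  simp only [Set.mem_iUnion, exists_prop]
  constructor
  · intro hX
    obtain ⟨J, hJI, hJ, hXJ⟩ := exists_countable_mem_densityFil hX
    exact ⟨J, ⟨hJI, hJ⟩, hXJ⟩
  · rintro ⟨J, hJ, hXJ⟩
    exact densityFil_mono hJ.1 hXJ
end

section
/- Let F be a filter on ℕ such that every member of F is infinite and F is closed under finite modifications. Then F is a Q-set if and only if for every strictly increasing function f : ℕ → ℕ there exists C ∈ F such that, letting {k_n : n ∈ ℕ} be the strictly increasing enumeration of C, f(k_n) < k_{n+1} for all n. -/
/-- A family `F` of subsets of `ℕ` is a Q-set: for every partition of `ℕ` into finite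
sets `{I_n : n ∈ ℕ}` there is `A ∈ F` with `|A ∩ I_n| ≤ 1` for all `n`. -/
def IsQSet (F : Set (Set ℕ)) : Prop :=
  ∀ I : ℕ → Set ℕ, (∀ n, (I n).Finite) → (∀ m n, m ≠ n → Disjoint (I m) (I n)) →
    (⋃ n, I n) = Set.univ → ∃ A ∈ F, ∀ n, (A ∩ I n).Subsingleton

theorem IsQSet.exists_injOn {F : Set (Set ℕ)} (hF : IsQSet F) (h : ℕ → ℕ)
    (hfin : ∀ n, (h ⁻¹' {n}).Finite) : ∃ A ∈ F, Set.InjOn h A := by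
  obtain ⟨A, hA, hsub⟩ := hF (fun n => h ⁻¹' {n}) hfin
    (fun m n hmn => Disjoint.preimage h (Set.disjoint_singleton.2 hmn))
    (Set.eq_univ_of_forall fun x => Set.mem_iUnion.2 ⟨h x, rfl⟩)
  exact ⟨A, hA, fun x hx y hy hxy => hsub (h y) ⟨hx, hxy⟩ ⟨hy, rfl⟩⟩

theorem Set.Infinite.forall_nth_lt_nth_succ_iff {C : Set ℕ} (hC : C.Infinite) {f : ℕ → ℕ} :
    (∀ n : ℕ, f (Nat.nth (· ∈ C) n) < Nat.nth (· ∈ C) (n + 1)) ↔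
      ∀ x ∈ C, ∀ y ∈ C, x < y → f x < y := by
  classical
  refine ⟨fun h x hx y hy hxy => ?_, fun h n => h _ (Nat.nth_mem_of_infinite hC n) _
    (Nat.nth_mem_of_infinite hC (n + 1)) (Nat.nth_strictMono hC n.lt_succ_self)⟩
  have hlt : Nat.count (· ∈ C) x < Nat.count (· ∈ C) y := Nat.count_strict_mono hx hxy
  calc f x = f (Nat.nth (· ∈ C) (Nat.count (· ∈ C) x)) := by rw [Nat.nth_count hx]
    _ < Nat.nth (· ∈ C) (Nat.count (· ∈ C) x + 1) := h _
    _ ≤ Nat.nth (· ∈ C) (Nat.count (· ∈ C) y) := (Nat.nth_strictMono hC).monotone hlt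
    _ = y := Nat.nth_count hy

/-- A strictly increasing `f` has a coarse scale `i` on `ℕ` with finite initial segments such
that points at least two steps apart on the scale are separated by `f`. -/
theorem StrictMono.exists_scale {f : ℕ → ℕ} (hf : StrictMono f) :
    ∃ i : ℕ → ℕ, Monotone i ∧ (∀ n, {x | i x ≤ n}.Finite) ∧
      ∀ x y, i x + 2 ≤ i y → f x < y := by
  let a : ℕ → ℕ := fun n => (fun m => f m + 1)^[n] 0
  have hsucc (n : ℕ) : a (n + 1) = f (a n) + 1 := Function.iterate_succ_apply' _ _ _
  have ha : StrictMono a := strictMono_nat_of_lt_succ fun n => by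
    rw [hsucc]; exact Nat.lt_succ_of_le hf.le_apply
  let i : ℕ → ℕ := fun x => Nat.findGreatest (fun j => a j ≤ x) x
  have hle (x : ℕ) : a (i x) ≤ x :=
    Nat.findGreatest_spec (P := fun j => a j ≤ x) (Nat.zero_le x) (Nat.zero_le x)
  have hi {j x : ℕ} (h : a j ≤ x) : j ≤ i x := Nat.le_findGreatest (ha.le_apply.trans h) h
  have hlt (x : ℕ) : x < a (i x + 1) := by
    by_contra! h
    exact absurd (hi h) (by omega)
  refine ⟨i, fun x y hxy => hi ((hle x).trans hxy), fun n => ?_, fun x y hxy => ?_⟩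
  · exact (Set.finite_Iio (a (n + 1))).subset fun x hx =>
      (hlt x).trans_le (ha.monotone (Nat.succ_le_succ hx))
  · calc f x < f (a (i x + 1)) := hf (hlt x)
      _ < a (i x + 2) := by rw [hsucc (i x + 1)]; exact Nat.lt_succ_self _
      _ ≤ a (i y) := ha.monotone hxy
      _ ≤ y := hle y

/-- A filter on `ℕ` with all members infinite and closed under finite modifications is a
Q-set iff for every strictly increasing `f : ℕ → ℕ` there is `C ∈ F` whose increasing
enumeration `⟨k_n⟩` satisfies `f(k_n) < k_{n+1}` for all `n`. -/
theorem isQSet_iff_fast_sets (F : Filter ℕ)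
    (hinf : ∀ A ∈ F, A.Infinite)
    (hmod : ∀ A ∈ F, ∀ B : Set ℕ, (symmDiff A B).Finite → B ∈ F) :
    IsQSet {A : Set ℕ | A ∈ F} ↔
      ∀ f : ℕ → ℕ, StrictMono f →
        ∃ C ∈ F, ∀ n : ℕ, f (Nat.nth (· ∈ C) n) < Nat.nth (· ∈ C) (n + 1) := by
  constructor
  · intro hQ f hf
    obtain ⟨i, hmono, hfin, hsep⟩ := hf.exists_scale
    obtain ⟨A, hA, hAinj⟩ := hQ.exists_injOn (fun x => i x / 2) fun n =>
      (hfin (2 * n + 1)).subset fun x (hx : i x / 2 = n) => by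
        change i x ≤ 2 * n + 1
        omega
    obtain ⟨B, hB, hBinj⟩ := hQ.exists_injOn (fun x => (i x + 1) / 2) fun n =>
      (hfin (2 * n)).subset fun x (hx : (i x + 1) / 2 = n) => by
        change i x ≤ 2 * n
        omega
    have hC : A ∩ B ∈ F := F.inter_sets hA hB
    refine ⟨A ∩ B, hC, (hinf _ hC).forall_nth_lt_nth_succ_iff.2 fun x hx y hy hxy => hsep x y ?_⟩
    have hle := hmono hxy.le
    have h₁ : i x / 2 ≠ i y / 2 := fun h => hxy.ne (hAinj hx.1 hy.1 h)
    have h₂ : (i x + 1) / 2 ≠ (i y + 1) / 2 := fun h => hxy.ne (hBinj hx.2 hy.2 h)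
    omega
  · intro h I hIfin hdisj hcover
    choose c hc using fun x => Set.mem_iUnion.1 (hcover ▸ Set.mem_univ x)
    choose b hb using fun n => (hIfin n).bddAbove
    have hf : StrictMono fun n => n + ∑ m ∈ Finset.range (n + 1), b (c m) :=
      strictMono_nat_of_lt_succ fun n => by
        rw [Finset.sum_range_succ _ (n + 1)]
        omega
    obtain ⟨C, hC, hfast⟩ := h _ hf
    have hsep {n x y : ℕ} (hx : x ∈ C ∩ I n) (hy : y ∈ C ∩ I n) : ¬ x < y := fun hxy => by
      have hcx : c x = n := by
        by_contra hne
        exact Set.disjoint_left.1 (hdisj _ _ hne) (hc x) hx.2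
      have hlt : x + ∑ m ∈ Finset.range (x + 1), b (c m) < y :=
        ((hinf C hC).forall_nth_lt_nth_succ_iff
          (f := fun n => n + ∑ m ∈ Finset.range (n + 1), b (c m))).1 hfast x hx.1 y hy.1 hxy
      have hyb : y ≤ b (c x) := hcx ▸ hb n hy.2
      have hsum : b (c x) ≤ ∑ m ∈ Finset.range (x + 1), b (c m) :=
        Finset.single_le_sum (f := fun m => b (c m)) (fun _ _ => Nat.zero_le _)
          (Finset.self_mem_range_succ x)
      omega
    exact ⟨C, hC, fun n x hx y hy => le_antisymm (not_lt.1 (hsep hy hx)) (not_lt.1 (hsep hx hy))⟩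
end
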